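/- arXiv:1407.3312 — 2 statements merged into one kernel-verified Lean document; each statement's English description precedes it below -/
import Mathlib

section
/- Let w_{nk} denote the number of strongly connected, complete digraphs on vertex set {1,...,n} with exactly k double edges, and set F_{nk} = ((n choose 2) choose k) · 2^((n choose 2) − k). Then w_{00} = 1 and, for n ≥ 1, w_{nk} = F_{nk} − ∑_{s=1}^{n−1} (n choose s) ∑_{l=0}^{k} w_{sl} · F_{n−s, k−l}. -/
/-- `w n k`: the number of strongly connected, complete digraphs on the vertex set `Fin n`
(sets of ordered pairs of distinct vertices; complete means that between any two distinct
vertices at least one of the two directed edges is present) having exactly `k` double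
edges. -/
noncomputable def w (n k : ℕ) : ℕ :=
  Nat.card {R : Fin n → Fin n → Prop //
    (∀ u, ¬ R u u) ∧
    (∀ u v, u ≠ v → R u v ∨ R v u) ∧
    (∀ u v, Relation.ReflTransGen R u v) ∧
    {p : Fin n × Fin n | p.1 < p.2 ∧ R p.1 p.2 ∧ R p.2 p.1}.ncard = k}

/-- `F n k = ((n choose 2) choose k) · 2^((n choose 2) − k)`. -/
def F (n k : ℕ) : ℕ := (n.choose 2).choose k * 2 ^ (n.choose 2 - k)

/-- The number of double edges of a relation on a linearly ordered type. -/
noncomputable def doubleCount {V : Type*} [LinearOrder V] (R : V → V → Prop) : ℕ :=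
  {p : V × V | p.1 < p.2 ∧ R p.1 p.2 ∧ R p.2 p.1}.ncard

/-- Irreflexive relations in which any two distinct vertices are joined by an edge. -/
def IsCompleteDigraph {V : Type*} (R : V → V → Prop) : Prop :=
  (∀ u, ¬ R u u) ∧ ∀ u v, u ≠ v → R u v ∨ R v u

open scoped Classical in
/-- The complete digraphs on `V` with `k` double edges. -/
noncomputable def completeDigraphs (V : Type*) [LinearOrder V] [Fintype V] (k : ℕ) :
    Finset (V → V → Prop) :=
  {R | IsCompleteDigraph R ∧ doubleCount R = k}

open scoped Classical in
/-- The strongly connected complete digraphs on `V` with `k` double edges. -/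
noncomputable def strongDigraphs (V : Type*) [LinearOrder V] [Fintype V] (k : ℕ) :
    Finset (V → V → Prop) :=
  {R | IsCompleteDigraph R ∧ (∀ u v, Relation.ReflTransGen R u v) ∧ doubleCount R = k}

open scoped Classical in
/-- The set of vertices from which every vertex can be reached. -/
noncomputable def sources {V : Type*} [Fintype V] (R : V → V → Prop) : Finset V :=
  {u | ∀ v, Relation.ReflTransGen R u v}

theorem mem_completeDigraphs {V : Type*} [LinearOrder V] [Fintype V] {k : ℕ}
    {R : V → V → Prop} :
    R ∈ completeDigraphs V k ↔ IsCompleteDigraph R ∧ doubleCount R = k := by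
  simp [completeDigraphs]

theorem mem_strongDigraphs {V : Type*} [LinearOrder V] [Fintype V] {k : ℕ}
    {R : V → V → Prop} :
    R ∈ strongDigraphs V k ↔
      IsCompleteDigraph R ∧ (∀ u v, Relation.ReflTransGen R u v) ∧ doubleCount R = k := by
  simp [strongDigraphs]

theorem mem_sources {V : Type*} [Fintype V] {R : V → V → Prop} {u : V} :
    u ∈ sources R ↔ ∀ v, Relation.ReflTransGen R u v := by
  simp [sources]

theorem w_eq_card (n k : ℕ) : w n k = (strongDigraphs (Fin n) k).card := by
  classical
  rw [w, Nat.card_eq_fintype_card, Fintype.card_subtype, strongDigraphs]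
  congr 1
  ext R
  simp [IsCompleteDigraph, doubleCount, and_assoc]

theorem doubleCount_comp_orderIso {V W : Type*} [LinearOrder V] [LinearOrder W]
    (e : V ≃o W) (R : W → W → Prop) :
    doubleCount (fun u v => R (e u) (e v)) = doubleCount R := by
  unfold doubleCount
  rw [← Set.ncard_image_of_injective _ (e.toEquiv.prodCongr e.toEquiv).injective]
  congr 1
  ext ⟨a, b⟩
  constructor
  · rintro ⟨⟨c, d⟩, h, h'⟩
    simp only [Equiv.prodCongr_apply, Prod.map_apply, Prod.mk.injEq] at h'
    obtain ⟨rfl, rfl⟩ := h'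
    simpa using h
  · intro h
    exact ⟨(e.symm a, e.symm b), by simpa using h, by simp⟩

theorem reflTransGen_comp_equiv {V W : Type*} (e : V ≃ W) (R : W → W → Prop)
    (h : ∀ u v, Relation.ReflTransGen R u v) (u v : V) :
    Relation.ReflTransGen (fun u v => R (e u) (e v)) u v := by
  have := Relation.ReflTransGen.lift (p := fun u v => R (e u) (e v)) e.symm
    (fun a b hab => by simpa [Function.onFun] using hab) _ _ (h (e u) (e v))
  simpa [Function.onFun] using this

theorem IsCompleteDigraph.comp_injective {V W : Type*} {R : W → W → Prop}
    (h : IsCompleteDigraph R) {e : V → W} (he : Function.Injective e) :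
    IsCompleteDigraph (fun u v => R (e u) (e v)) :=
  ⟨fun _ => h.1 _, fun _ _ huv => h.2 _ _ (he.ne huv)⟩

theorem card_strongDigraphs_congr {V W : Type*} [LinearOrder V] [LinearOrder W]
    [Fintype V] [Fintype W] (e : V ≃o W) (k : ℕ) :
    (strongDigraphs V k).card = (strongDigraphs W k).card := by
  refine Finset.card_bij' (fun R _ a b => R (e.symm a) (e.symm b))
    (fun R _ a b => R (e a) (e b)) ?_ ?_ ?_ ?_
  · intro R hR
    rw [mem_strongDigraphs] at hR ⊢
    exact ⟨hR.1.comp_injective e.symm.injective,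
      reflTransGen_comp_equiv e.symm.toEquiv R hR.2.1,
      (doubleCount_comp_orderIso e.symm R).trans hR.2.2⟩
  · intro R hR
    rw [mem_strongDigraphs] at hR ⊢
    exact ⟨hR.1.comp_injective e.injective,
      reflTransGen_comp_equiv e.toEquiv R hR.2.1,
      (doubleCount_comp_orderIso e R).trans hR.2.2⟩
  · intro R _
    simp
  · intro R _
    simp

theorem card_strongDigraphs (V : Type*) [LinearOrder V] [Fintype V] (k : ℕ) :
    (strongDigraphs V k).card = w (Fintype.card V) k := by
  rw [w_eq_card, card_strongDigraphs_congr (Fintype.orderIsoFinOfCardEq V rfl)]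

theorem card_lt_pairs (V : Type*) [LinearOrder V] [Fintype V] :
    Fintype.card {p : V × V // p.1 < p.2} = (Fintype.card V).choose 2 := by
  classical
  rw [← Sym2.card_diagSet_compl]
  refine Fintype.card_of_bijective
    (f := fun p => ⟨s(p.1.1, p.1.2), by simpa using p.2.ne⟩) ⟨?_, ?_⟩
  · rintro ⟨⟨a, b⟩, hab⟩ ⟨⟨c, d⟩, hcd⟩ h
    simp only [Subtype.mk.injEq, Sym2.eq_iff] at h
    rcases h with ⟨rfl, rfl⟩ | ⟨rfl, rfl⟩
    · rfl
    · exact absurd hab hcd.not_gt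
  · rintro ⟨e, he⟩
    induction e using Sym2.ind with
    | _ a b =>
      rcases lt_or_gt_of_ne (show a ≠ b by simpa using he) with h | h
      · exact ⟨⟨(a, b), h⟩, rfl⟩
      · exact ⟨⟨(b, a), h⟩, Subtype.ext Sym2.eq_swap⟩

theorem card_completeDigraphs (V : Type*) [LinearOrder V] [Fintype V] (k : ℕ) :
    (completeDigraphs V k).card = F (Fintype.card V) k := by
  classical
  let E := {p : V × V // p.1 < p.2}
  have hE : (((Finset.univ : Finset E).powersetCard k).sigma fun A => Aᶜ.powerset).card
      = F (Fintype.card V) k := by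
    rw [Finset.card_sigma, Finset.sum_congr rfl (g := fun _ => 2 ^ (Fintype.card E - k))]
    · rw [Finset.sum_const, Finset.card_powersetCard, Finset.card_univ, card_lt_pairs, F,
        smul_eq_mul]
    · intro A hA
      rw [Finset.card_powerset, Finset.card_compl, (Finset.mem_powersetCard.1 hA).2]
  rw [← hE]
  refine Finset.card_bij'
    (fun R _ => ⟨({e | R e.1.1 e.1.2 ∧ R e.1.2 e.1.1} : Finset E),
      ({e | R e.1.1 e.1.2 ∧ ¬ R e.1.2 e.1.1} : Finset E)⟩)
    (fun X _ u v => (∃ h : u < v, (⟨(u, v), h⟩ : E) ∈ X.1 ∨ (⟨(u, v), h⟩ : E) ∈ X.2) ∨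
      ∃ h : v < u, (⟨(v, u), h⟩ : E) ∉ X.2) ?_ ?_ ?_ ?_
  · intro R hR
    rw [mem_completeDigraphs] at hR
    simp only [Finset.mem_sigma, Finset.mem_powersetCard, Finset.subset_univ, true_and,
      Finset.mem_powerset]
    constructor
    · rw [← hR.2, doubleCount, ← Set.ncard_coe_finset,
        ← Set.ncard_image_of_injective _ (Subtype.val_injective)]
      congr 1
      ext p
      constructor
      · rintro ⟨e, he, rfl⟩
        exact ⟨e.2, (Finset.mem_filter.1 he).2⟩
      · intro h
        exact ⟨⟨p, h.1⟩, Finset.mem_filter.2 ⟨Finset.mem_univ _, h.2⟩, rfl⟩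
    · intro e
      simp
      tauto
  · rintro ⟨A, B⟩ hX
    simp only [Finset.mem_sigma, Finset.mem_powersetCard, Finset.subset_univ, true_and,
      Finset.mem_powerset] at hX
    have hAB : ∀ e ∈ A, e ∉ B := fun e he hB => by simpa [he] using hX.2 hB
    rw [mem_completeDigraphs]
    refine ⟨⟨fun u => by simp, fun u v huv => ?_⟩, ?_⟩
    · rcases lt_or_gt_of_ne huv with h | h
      · simp only [h, h.not_gt, IsEmpty.exists_iff, exists_true_left]
        tauto
      · simp only [h, h.not_gt, IsEmpty.exists_iff, exists_true_left]
        tauto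
    · rw [← hX.1, doubleCount, ← Set.ncard_coe_finset,
        ← Set.ncard_image_of_injective _ (Subtype.val_injective)]
      congr 1
      ext ⟨u, v⟩
      constructor
      · rintro ⟨h, h1, h2⟩
        simp only [] at h
        simp only [h, h.not_gt, IsEmpty.exists_iff, exists_true_left] at h1 h2
        exact ⟨⟨(u, v), h⟩, by simp; tauto, rfl⟩
      · rintro ⟨⟨⟨a, b⟩, h⟩, h1, h2⟩
        cases h2
        simp only [] at h
        have h3 := hAB _ h1
        have h1' : (⟨(u, v), h⟩ : E) ∈ A := h1
        simp only [Set.mem_ofPred_eq, h, h.not_gt, IsEmpty.exists_iff, exists_true_left]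
        tauto
  · intro R hR
    rw [mem_completeDigraphs] at hR
    funext u v
    rcases lt_trichotomy u v with h | rfl | h
    · simp [h, h.not_gt]
      tauto
    · simpa using hR.1.1 u
    · have := hR.1.2 u v h.ne'
      simp [h, h.not_gt]
      tauto
  · rintro ⟨A, B⟩ hX
    simp only [Finset.mem_sigma, Finset.mem_powersetCard, Finset.subset_univ, true_and,
      Finset.mem_powerset] at hX
    have hAB : ∀ e ∈ A, e ∉ B := fun e he hB => by simpa [he] using hX.2 hB
    congr 1
    · ext ⟨⟨u, v⟩, h⟩
      have h3 := hAB ⟨(u, v), h⟩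
      simp only [] at h
      simp [h, h.not_gt]
      tauto
    · ext ⟨⟨u, v⟩, h⟩
      have h3 := hAB ⟨(u, v), h⟩
      simp only [] at h
      simp [h, h.not_gt]
      tauto

theorem sources_nonempty {V : Type*} [Fintype V] [Nonempty V] {R : V → V → Prop}
    (hR : IsCompleteDigraph R) : (sources R).Nonempty := by
  classical
  have key : ∀ T : Finset V, ∃ u, ∀ v ∈ T, Relation.ReflTransGen R u v := by
    intro T
    induction T using Finset.induction_on with
    | empty => exact ⟨Classical.arbitrary V, by simp⟩
    | insert a T _ ih =>
      obtain ⟨u, hu⟩ := ih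
      by_cases hua : Relation.ReflTransGen R u a
      · exact ⟨u, by simpa [hua] using hu⟩
      · have hne : u ≠ a := fun h => hua (h ▸ .refl)
        have hau : R a u := (hR.2 u a hne).resolve_left fun h => hua (.single h)
        refine ⟨a, fun v hv => ?_⟩
        rcases Finset.mem_insert.1 hv with rfl | hv
        · exact .refl
        · exact .head hau (hu v hv)
  obtain ⟨u, hu⟩ := key Finset.univ
  exact ⟨u, mem_sources.2 fun v => hu v (Finset.mem_univ v)⟩

theorem mem_sources_of_rel {V : Type*} [Fintype V] {R : V → V → Prop} {u v : V}
    (hv : v ∈ sources R) (h : R u v) : u ∈ sources R :=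
  mem_sources.2 fun x => .head h (mem_sources.1 hv x)

theorem reflTransGen_restrict_of_closed {V : Type*} {R : V → V → Prop} {S : Finset V}
    (hS : ∀ u v, v ∈ S → R u v → u ∈ S) {u v : V} (h : Relation.ReflTransGen R u v)
    (hv : v ∈ S) : ∃ hu : u ∈ S, Relation.ReflTransGen
      (fun a b : {x // x ∈ S} => R a b) ⟨u, hu⟩ ⟨v, hv⟩ := by
  induction h using Relation.ReflTransGen.head_induction_on with
  | refl => exact ⟨hv, .refl⟩
  | head hab _ ih =>
    obtain ⟨hb, ih⟩ := ih
    exact ⟨hS _ _ hb hab, .head hab ih⟩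

/-- The sources are the unique nonempty predecessor-closed strongly connected set. -/
theorem sources_eq_iff {V : Type*} [Fintype V] {R : V → V → Prop}
    (hR : IsCompleteDigraph R) {S : Finset V} (hS : S.Nonempty) :
    sources R = S ↔ (∀ u v, v ∈ S → R u v → u ∈ S) ∧
      ∀ u v : {x // x ∈ S}, Relation.ReflTransGen (fun a b : {x // x ∈ S} => R a b) u v := by
  constructor
  · rintro rfl
    have hc : ∀ u v, v ∈ sources R → R u v → u ∈ sources R :=
      fun u v hv h => mem_sources_of_rel hv h
    exact ⟨hc, fun u v =>
      (reflTransGen_restrict_of_closed hc (mem_sources.1 u.2 v) v.2).2⟩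
  · rintro ⟨hc, hs⟩
    ext u
    constructor
    · intro hu
      obtain ⟨v, hv⟩ := hS
      exact (reflTransGen_restrict_of_closed hc (mem_sources.1 hu v) hv).1
    · intro hu
      refine mem_sources.2 fun v => ?_
      by_cases hv : v ∈ S
      · exact Relation.ReflTransGen.lift (p := R) Subtype.val (fun _ _ h => h)
          _ _ (hs ⟨u, hu⟩ ⟨v, hv⟩)
      · exact .single ((hR.2 u v fun h => hv (h ▸ hu)).resolve_right
          fun h => hv (hc v u hu h))

theorem doubleCount_eq_add {V : Type*} [LinearOrder V] [Fintype V] {R : V → V → Prop}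
    {S : Finset V} (hS : ∀ u v, v ∈ S → R u v → u ∈ S) :
    doubleCount R = doubleCount (fun a b : {x // x ∈ S} => R a b) +
      doubleCount (fun a b : {x // x ∉ S} => R a b) := by
  unfold doubleCount
  rw [← Set.ncard_image_of_injective _
      (Subtype.val_injective (p := (· ∈ S)).prodMap Subtype.val_injective),
    ← Set.ncard_image_of_injective _
      (Subtype.val_injective (p := (· ∉ S)).prodMap Subtype.val_injective),
    ← Set.ncard_union_eq]
  · congr 1
    ext ⟨u, v⟩
    constructor
    · rintro ⟨h, h1, h2⟩
      by_cases hu : u ∈ S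
      · exact .inl ⟨(⟨u, hu⟩, ⟨v, hS _ _ hu h2⟩), ⟨h, h1, h2⟩, rfl⟩
      · exact .inr ⟨(⟨u, hu⟩, ⟨v, fun hv => hu (hS _ _ hv h1)⟩), ⟨h, h1, h2⟩, rfl⟩
    · rintro (⟨p, hp, h⟩ | ⟨p, hp, h⟩) <;> cases h <;> exact hp
  · rw [Set.disjoint_left]
    rintro _ ⟨p, _, rfl⟩ ⟨q, _, h⟩
    have h' : q.1.1 = p.1.1 := congrArg Prod.fst h
    exact q.1.2 (h' ▸ p.1.2)

/-- The digraph in which `A` lives on `S`, `B` lives off `S`, and all edges between the two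
parts point out of `S`. -/
def joinDigraph {V : Type*} (S : Finset V) (A : {x // x ∈ S} → {x // x ∈ S} → Prop)
    (B : {x // x ∉ S} → {x // x ∉ S} → Prop) (u v : V) : Prop :=
  (∃ hu hv, A ⟨u, hu⟩ ⟨v, hv⟩) ∨ (∃ hu hv, B ⟨u, hu⟩ ⟨v, hv⟩) ∨ (u ∈ S ∧ v ∉ S)

theorem joinDigraph_inside {V : Type*} (S : Finset V)
    (A : {x // x ∈ S} → {x // x ∈ S} → Prop) (B : {x // x ∉ S} → {x // x ∉ S} → Prop) :
    (fun a b : {x // x ∈ S} => joinDigraph S A B a b) = A := by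
  funext a b
  simp [joinDigraph]

theorem joinDigraph_outside {V : Type*} (S : Finset V)
    (A : {x // x ∈ S} → {x // x ∈ S} → Prop) (B : {x // x ∉ S} → {x // x ∉ S} → Prop) :
    (fun a b : {x // x ∉ S} => joinDigraph S A B a b) = B := by
  funext a b
  simp [joinDigraph, a.2, b.2]

theorem joinDigraph_closed {V : Type*} (S : Finset V)
    (A : {x // x ∈ S} → {x // x ∈ S} → Prop) (B : {x // x ∉ S} → {x // x ∉ S} → Prop)
    (u v : V) (hv : v ∈ S) (h : joinDigraph S A B u v) : u ∈ S := by
  rcases h with ⟨hu, _⟩ | ⟨_, hv', _⟩ | ⟨hu, _⟩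
  · exact hu
  · exact absurd hv hv'
  · exact hu

theorem IsCompleteDigraph.join {V : Type*} {S : Finset V}
    {A : {x // x ∈ S} → {x // x ∈ S} → Prop} {B : {x // x ∉ S} → {x // x ∉ S} → Prop}
    (hA : IsCompleteDigraph A) (hB : IsCompleteDigraph B) :
    IsCompleteDigraph (joinDigraph S A B) := by
  constructor
  · intro u
    by_cases hu : u ∈ S
    · simpa [joinDigraph, hu] using hA.1 ⟨u, hu⟩
    · simpa [joinDigraph, hu] using hB.1 ⟨u, hu⟩
  · intro u v huv
    by_cases hu : u ∈ S <;> by_cases hv : v ∈ S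
    · simpa [joinDigraph, hu, hv] using hA.2 ⟨u, hu⟩ ⟨v, hv⟩ (by simpa using huv)
    · simp [joinDigraph, hu, hv]
    · simp [joinDigraph, hu, hv]
    · simpa [joinDigraph, hu, hv] using hB.2 ⟨u, hu⟩ ⟨v, hv⟩ (by simpa using huv)

theorem joinDigraph_restrict {V : Type*} {S : Finset V} {R : V → V → Prop}
    (hR : IsCompleteDigraph R) (hS : ∀ u v, v ∈ S → R u v → u ∈ S) :
    joinDigraph S (fun a b => R a b) (fun a b => R a b) = R := by
  funext u v
  have h1 := hS u v
  have h2 := hS v u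
  have h3 := hR.2 u v
  by_cases hu : u ∈ S <;> by_cases hv : v ∈ S
  · simp [joinDigraph, hu, hv]
  · have := h3 fun h => hv (h ▸ hu)
    simp [joinDigraph, hu, hv]
    tauto
  · simp [joinDigraph, hu, hv]
    tauto
  · simp [joinDigraph, hu, hv]

theorem card_filter_sources_eq {V : Type*} [LinearOrder V] [Fintype V] (k : ℕ)
    {S : Finset V} (hS : S.Nonempty) :
    ((completeDigraphs V k).filter fun R => sources R = S).card =
      ∑ l ∈ Finset.range (k + 1),
        w S.card l * F (Fintype.card V - S.card) (k - l) := by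
  classical
  have hT : ((Finset.HasAntidiagonal.antidiagonal k).sigma fun p =>
      strongDigraphs {x // x ∈ S} p.1 ×ˢ completeDigraphs {x // x ∉ S} p.2).card =
      ∑ l ∈ Finset.range (k + 1), w S.card l * F (Fintype.card V - S.card) (k - l) := by
    rw [Finset.card_sigma, ← Finset.Nat.sum_antidiagonal_eq_sum_range_succ
      (fun a b => w S.card a * F (Fintype.card V - S.card) b)]
    refine Finset.sum_congr rfl fun p _ => ?_
    rw [Finset.card_product, card_strongDigraphs, card_completeDigraphs,
      Fintype.card_subtype_compl, Fintype.card_coe]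
  rw [← hT]
  refine Finset.card_bij'
    (fun R _ => ⟨(doubleCount (fun a b : {x // x ∈ S} => R a b),
      doubleCount (fun a b : {x // x ∉ S} => R a b)), (fun a b => R a b, fun a b => R a b)⟩)
    (fun X _ => joinDigraph S X.2.1 X.2.2) ?_ ?_ ?_ ?_
  · intro R hR
    rw [Finset.mem_filter, mem_completeDigraphs] at hR
    obtain ⟨⟨hc, hk⟩, hs⟩ := hR
    rw [sources_eq_iff hc hS] at hs
    simp only [Finset.mem_sigma, Finset.HasAntidiagonal.mem_antidiagonal, Finset.mem_product,
      mem_strongDigraphs, mem_completeDigraphs, and_true]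
    exact ⟨(doubleCount_eq_add hs.1).symm.trans hk,
      ⟨hc.comp_injective Subtype.val_injective, hs.2⟩,
      hc.comp_injective Subtype.val_injective⟩
  · rintro ⟨⟨a, b⟩, A, B⟩ hX
    simp only [Finset.mem_sigma, Finset.HasAntidiagonal.mem_antidiagonal, Finset.mem_product,
      mem_strongDigraphs, mem_completeDigraphs] at hX
    obtain ⟨hk, ⟨hA, hAs, rfl⟩, hB, rfl⟩ := hX
    have hc := hA.join hB
    rw [Finset.mem_filter, mem_completeDigraphs, sources_eq_iff hc hS,
      doubleCount_eq_add (joinDigraph_closed S A B), joinDigraph_inside,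
      joinDigraph_outside]
    exact ⟨⟨hc, hk⟩, joinDigraph_closed S A B, hAs⟩
  · intro R hR
    rw [Finset.mem_filter, mem_completeDigraphs] at hR
    obtain ⟨⟨hc, -⟩, hs⟩ := hR
    rw [sources_eq_iff hc hS] at hs
    exact joinDigraph_restrict hc hs.1
  · rintro ⟨⟨a, b⟩, A, B⟩ hX
    simp only [Finset.mem_sigma, Finset.HasAntidiagonal.mem_antidiagonal, Finset.mem_product,
      mem_strongDigraphs, mem_completeDigraphs] at hX
    obtain ⟨hk, ⟨hA, hAs, rfl⟩, hB, rfl⟩ := hX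
    simp only [joinDigraph_inside, joinDigraph_outside]

theorem F_eq_sum (n k : ℕ) (hn : 1 ≤ n) :
    F n k = ∑ s ∈ Finset.Ico 1 (n + 1), n.choose s *
      ∑ l ∈ Finset.range (k + 1), w s l * F (n - s) (k - l) := by
  classical
  have : Nonempty (Fin n) := ⟨⟨0, hn⟩⟩
  let f : ℕ → ℕ := fun s =>
    if s = 0 then 0 else ∑ l ∈ Finset.range (k + 1), w s l * F (n - s) (k - l)
  have hF : F n k = ∑ S : Finset (Fin n), f S.card := by
    have h := card_completeDigraphs (Fin n) k
    rw [Fintype.card_fin] at h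
    rw [← h, Finset.card_eq_sum_card_fiberwise (f := sources) (t := Finset.univ) (by simp)]
    refine Finset.sum_congr rfl fun S _ => ?_
    rcases S.eq_empty_or_nonempty with rfl | hS
    · simp only [f, Finset.card_empty, if_true, Finset.card_eq_zero,
        Finset.filter_eq_empty_iff]
      intro R hR
      exact (sources_nonempty (mem_completeDigraphs.1 hR).1).ne_empty
    · rw [card_filter_sources_eq k hS]
      simp [f, hS.ne_empty]
  rw [hF, ← Finset.powerset_univ, Finset.sum_powerset_apply_card, Finset.card_univ,
    Fintype.card_fin, Finset.range_eq_Ico, Finset.sum_eq_sum_Ico_succ_bot (Nat.succ_pos n)]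
  simp only [f, if_true, smul_eq_mul, mul_zero, zero_add]
  refine Finset.sum_congr rfl fun s hs => ?_
  rw [if_neg (by have := (Finset.mem_Ico.1 hs).1; omega)]

theorem sum_w_mul_F_zero (n k : ℕ) :
    ∑ l ∈ Finset.range (k + 1), w n l * F 0 (k - l) = w n k := by
  rw [Finset.sum_range_succ, Finset.sum_eq_zero]
  · simp [F]
  · intro l hl
    have : 0 < k - l := by have := Finset.mem_range.1 hl; omega
    simp [F, Nat.choose_eq_zero_of_lt this]

theorem w_zero_zero : w 0 0 = 1 := by
  rw [w_eq_card, Finset.card_eq_one]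
  refine ⟨fun _ _ => True, ?_⟩
  ext R
  have h : {p : Fin 0 × Fin 0 | p.1 < p.2} = ∅ := Subsingleton.elim _ _
  simp [mem_strongDigraphs, IsCompleteDigraph, doubleCount, h,
    Subsingleton.elim R fun _ _ => True]

/-- `w_{00} = 1` and, for `n ≥ 1` and `0 ≤ k ≤ (n choose 2)`,
`w_{nk} = F_{nk} − ∑_{s=1}^{n-1} (n choose s) ∑_{l=0}^{k} w_{sl}·F_{n-s,k-l}`. -/
theorem stmt_7 :
    w 0 0 = 1 ∧ ∀ n k : ℕ, 1 ≤ n → k ≤ n.choose 2 →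
      (w n k : ℤ) = F n k
        - ∑ s ∈ Finset.Ico 1 n, (n.choose s : ℤ) *
            ∑ l ∈ Finset.range (k + 1), (w s l : ℤ) * F (n - s) (k - l) := by
  refine ⟨w_zero_zero, fun n k hn _ => ?_⟩
  have h := F_eq_sum n k hn
  rw [Finset.sum_Ico_succ_top hn, Nat.choose_self, one_mul, Nat.sub_self,
    sum_w_mul_F_zero] at h
  rw [h]
  push_cast
  ring
end

section
/- Let m,n ≥ 2, X = {1,...,m} × {1,...,n}, P the partition of X into blocks C_i = {i} × {1,...,n}, and S = E(X,P) the submonoid of T(X,P) generated by its idempotents. Let V ⊆ E(D_m) be a set of rank-(m−1) idempotents of T_m generating T_m \ S_m as a semigroup; let Ξ_V = {(i,j) : i < j, both e_{ij} ∈ V and e_{ji} ∈ V} and Φ_V = {(i,j) : e_{ij} ∈ V but e_{ji} ∉ V}. For each (i,j) ∈ Ξ_V choose non-empty sets A_{ij}, B_{ij} with S_n the disjoint union of A_{ij} and B_{ij}, and set W = ⋃_{(i,j)∈Φ_V} {e_{ij;f} : f ∈ S_n} ∪ ⋃_{(i,j)∈Ξ_V} ({e_{ij;f} : f ∈ A_{ij}}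 ∪ {e_{ji;f^{−1}} : f ∈ B_{ij}}). Then W consists of idempotents of T(X,P), the subsemigroup generated by W equals S_3 = {f ∈ T(X,P) : f̄ ∈ T_m \ S_m and f_1,...,f_m ∈ S_n}, and |W| = n!·(m choose 2). -/
/-- `BP f` says that `f : X → X`, with `X = {1,…,m} × {1,…,n}`, preserves the partition of
`X` into the blocks `C_i = {i} × {1,…,n}`, i.e. `f ∈ T(X,P)`. -/
def BP {m n : ℕ} (f : Fin m × Fin n → Fin m × Fin n) : Prop :=
  ∀ i : Fin m, ∃ j : Fin m, ∀ x : Fin n, (f (i, x)).1 = j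

/-- `fbar hn f = f̄`, the induced transformation of `{1,…,m}` (for `f ∈ T(X,P)`). -/
def fbar {m n : ℕ} (hn : 0 < n) (f : Fin m × Fin n → Fin m × Fin n) (i : Fin m) : Fin m :=
  (f (i, ⟨0, hn⟩)).1

/-- `comp' f i = f_i`, the `i`-th component of `f ∈ T(X,P)` acting on `{1,…,n}`. -/
def comp' {m n : ℕ} (f : Fin m × Fin n → Fin m × Fin n) (i : Fin m) (x : Fin n) : Fin n :=
  (f (i, x)).2

/-- The idempotent `e_{i j}` of the full transformation monoid on `Fin m`, mapping `j` to `i`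
and fixing all other points. -/
def eij {m : ℕ} (i j : Fin m) : Function.End (Fin m) :=
  fun x => if x = j then i else x

/-- `eijf i j g = e_{ij;g} = [1,…,1,g,1,…,1; e_{ij}]`, with `g` in the `j`-th position. -/
def eijf {m n : ℕ} (i j : Fin m) (g : Fin n → Fin n) : Function.End (Fin m × Fin n) :=
  fun p => (if p.1 = j then i else p.1, if p.1 = j then g p.2 else p.2)

/-- The element `[F_1,…,F_m; φ]` of `T(X,P)` whose components are permutations. -/
def blockMap {m n : ℕ} (F : Fin m → Equiv.Perm (Fin n)) (φ : Function.End (Fin m)) :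
    Function.End (Fin m × Fin n) :=
  fun p => (φ p.1, F p.1 p.2)

lemma end_mul_apply {α : Type*} (f g : Function.End α) (x : α) : (f * g) x = f (g x) := rfl

lemma end_one_apply {α : Type*} (x : α) : (1 : Function.End α) x = x := rfl

lemma blockMap_mul {m n : ℕ} (F G : Fin m → Equiv.Perm (Fin n)) (φ ψ : Function.End (Fin m)) :
    blockMap F φ * blockMap G ψ = blockMap (fun c => F (ψ c) * G c) (φ * ψ) := rfl

lemma blockMap_congr {m n : ℕ} {F G : Fin m → Equiv.Perm (Fin n)} {φ ψ : Function.End (Fin m)}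
    (hF : ∀ c, F c = G c) (hφ : ∀ c, φ c = ψ c) : blockMap F φ = blockMap G ψ := by
  rw [funext hF, show φ = ψ from funext hφ]

lemma eijf_eq_blockMap {m n : ℕ} (i j : Fin m) (g : Equiv.Perm (Fin n)) :
    eijf i j ⇑g = blockMap (Pi.mulSingle j g) (eij i j) := by
  funext p
  by_cases h : p.1 = j
  · simp [eijf, blockMap, eij, h]
  · simp [eijf, blockMap, eij, h]

lemma eijf_inj {m n : ℕ} (hn : 0 < n) {i j i' j' : Fin m} (hij : i ≠ j)
    {f f' : Equiv.Perm (Fin n)} (h : eijf i j ⇑f = eijf i' j' ⇑f') :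
    i = i' ∧ j = j' ∧ f = f' := by
  have hj : j = j' := by
    by_contra hne
    have := congrArg Prod.fst (congrFun h (j, ⟨0, hn⟩))
    simp [eijf, hne] at this
    exact hij this
  subst hj
  refine ⟨?_, rfl, ?_⟩
  · have := congrArg Prod.fst (congrFun h (j, ⟨0, hn⟩))
    simpa [eijf] using this
  · ext1 x
    have := congrArg Prod.snd (congrFun h (j, x))
    simpa [eijf] using this

lemma eij_self {m : ℕ} (i : Fin m) : eij i i = (1 : Function.End (Fin m)) := by
  funext x
  by_cases h : x = i <;> simp [eij, end_one_apply, h]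

lemma not_bijective_eij {m : ℕ} {i j : Fin m} (h : i ≠ j) :
    ¬ Function.Bijective (eij i j) := fun hb =>
  h (hb.1 (by simp [eij]))

lemma not_bijective_mul_of_right {m : ℕ} {φ ψ : Function.End (Fin m)}
    (h : ¬ Function.Bijective ψ) : ¬ Function.Bijective (φ * ψ) := fun hb =>
  h (Finite.injective_iff_bijective.1 (Function.Injective.of_comp (f := φ) hb.1))

lemma not_bijective_mul_of_left {m : ℕ} {φ ψ : Function.End (Fin m)}
    (h : ¬ Function.Bijective φ) : ¬ Function.Bijective (φ * ψ) := fun hb =>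
  h (Finite.surjective_iff_bijective.1 (Function.Surjective.of_comp (g := ψ) hb.2))

/-- A set of idempotents `e_{pq}` whose generated semigroup contains `e_{ij}` meets
`{e_{ij}, e_{ji}}`. -/
lemma eij_mem_or_eij_mem {m : ℕ} {V : Set (Function.End (Fin m))}
    (hV : V ⊆ {f : Function.End (Fin m) | ∃ i j : Fin m, i ≠ j ∧ f = eij i j})
    {i j : Fin m} (hij : eij i j ∈ Subsemigroup.closure V) :
    eij i j ∈ V ∨ eij j i ∈ V := by
  have key : ∀ x ∈ Subsemigroup.closure V, ∃ v ∈ V, ∀ a b, v a = v b → x a = x b := by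
    intro x hx
    induction hx using Subsemigroup.closure_induction with
    | mem x hx => exact ⟨x, hx, fun _ _ h => h⟩
    | mul x y _ _ _ hy =>
      obtain ⟨v, hv, h⟩ := hy
      exact ⟨v, hv, fun a b hab => congrArg x (h a b hab)⟩
  obtain ⟨v, hv, h⟩ := key _ hij
  obtain ⟨p, q, hpq, rfl⟩ := hV hv
  have hk := h p q (by simp [eij])
  have : (p = i ∧ q = j) ∨ (p = j ∧ q = i) := by
    simp only [eij] at hk
    split_ifs at hk with h1 h2 h2
    · exact absurd (h1.trans h2.symm) hpq
    · exact Or.inr ⟨h1, hk.symm⟩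
    · exact Or.inl ⟨hk, h2⟩
    · exact absurd hk hpq
  rcases this with ⟨rfl, rfl⟩ | ⟨rfl, rfl⟩
  · exact Or.inl hv
  · exact Or.inr hv

/-- `e_{pq;g}` is a power of `e_{pq;f} e_{qp;g⁻¹}`. -/
lemma eijf_mem_of_mem_of_inv_mem {m n : ℕ} (T : Subsemigroup (Function.End (Fin m × Fin n)))
    {p q : Fin m} (hpq : p ≠ q) {f g : Equiv.Perm (Fin n)}
    (hf : eijf p q ⇑f ∈ T) (hg : eijf q p ⇑g⁻¹ ∈ T) : eijf p q ⇑g ∈ T := by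
  rw [eijf_eq_blockMap] at *
  have hx := T.mul_mem hf hg
  have key : ∀ k : ℕ, blockMap (Pi.mulSingle p ((f * g⁻¹) ^ (k + 1)) *
      Pi.mulSingle q ((f * g⁻¹) ^ (k + 1) * g)) (eij p q) ∈ T := by
    intro k
    induction k with
    | zero =>
      convert hx using 1
      rw [blockMap_mul]
      clear hx hf hg
      apply blockMap_congr <;> intro c <;> by_cases h1 : c = p <;> by_cases h2 : c = q <;>
        simp_all [eij, end_mul_apply]
    | succ k ih =>
      convert T.mul_mem hx ih using 1
      rw [blockMap_mul, blockMap_mul]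
      clear hx hf hg ih
      apply blockMap_congr <;> intro c <;> by_cases h1 : c = p <;> by_cases h2 : c = q <;>
        simp_all [eij, end_mul_apply, pow_succ', mul_assoc]
  have h := key (orderOf (f * g⁻¹) - 1)
  rw [Nat.sub_add_cancel (orderOf_pos _), pow_orderOf_eq_one] at h
  simpa using h

/-- If `T` contains all `e_{ij;g}` and an element above every singular map, then the components
of `e_{ij;1}` can be adjusted freely within `T`. -/
lemma blockMap_eij_mem {m n : ℕ} (T : Subsemigroup (Function.End (Fin m × Fin n)))
    {i j : Fin m} (hij : i ≠ j)
    (hT : ∀ g : Equiv.Perm (Fin n), eijf i j ⇑g ∈ T)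
    (hlift : ∀ φ : Function.End (Fin m), ¬ Function.Bijective φ →
      ∃ F : Fin m → Equiv.Perm (Fin n), blockMap F φ ∈ T)
    (D : Fin m → Equiv.Perm (Fin n)) :
    blockMap D 1 * eijf i j ⇑(1 : Equiv.Perm (Fin n)) ∈ T := by
  let M : Submonoid (Fin m → Equiv.Perm (Fin n)) :=
    { carrier := {D | blockMap D 1 * eijf i j ⇑(1 : Equiv.Perm (Fin n)) ∈ T}
      one_mem' := hT 1
      mul_mem' := by
        intro D E hD hE
        have h := T.mul_mem hD hE
        change _ ∈ T
        convert h using 1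
        simp only [eijf_eq_blockMap, blockMap_mul]
        apply blockMap_congr <;> intro c <;> by_cases h1 : c = j <;>
          simp_all [eij, end_mul_apply, end_one_apply] }
  have hinv : ∀ D ∈ M, D⁻¹ ∈ M := by
    intro D hD
    have h : D⁻¹ = D ^ (orderOf D - 1) := by
      rw [inv_eq_iff_mul_eq_one, ← pow_succ', Nat.sub_add_cancel (orderOf_pos D),
        pow_orderOf_eq_one]
    rw [h]
    exact M.pow_mem hD _
  refine Submonoid.pi_mem_of_mulSingle_mem (H := M) D fun a => ?_
  generalize D a = s
  by_cases haj : a = j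
  · subst haj
    have h := hT 1
    change _ ∈ T
    convert h using 1
    simp only [eijf_eq_blockMap, blockMap_mul]
    apply blockMap_congr <;> intro c <;> by_cases h1 : c = a <;>
      simp_all [eij, end_mul_apply, end_one_apply]
  let σ : Function.End (Fin m) := fun x => Equiv.swap a i x
  obtain ⟨X, hX⟩ := hlift (σ * eij i j)
    (not_bijective_mul_of_right (not_bijective_eij hij))
  obtain ⟨R, hR⟩ := hlift (eij j i * (σ * eij i j))
    (not_bijective_mul_of_left (not_bijective_eij hij.symm))
  have hprod : ∀ h : Equiv.Perm (Fin n),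
      Pi.mulSingle a (X i * h * (X i)⁻¹) * (fun c => X (σ (eij i j c)) * R c) ∈ M := by
    intro h
    have ht := T.mul_mem (T.mul_mem hX (T.mul_mem (hT h) hR)) (hT 1)
    change _ ∈ T
    convert ht using 1
    simp only [eijf_eq_blockMap, blockMap_mul]
    have key : ∀ d, d ≠ j → eij i j (eij j i (σ d)) = σ d ∧ eij i j d = d ∧
        eij i j (σ d) = σ d ∧ σ (σ d) = d ∧ (d = a → eij j i (σ d) = j ∧ σ d = i) ∧
        (d ≠ a → eij j i (σ d) ≠ j) := by
      intro d hd
      have hσ : σ d ≠ j := by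
        simp only [σ, Equiv.swap_apply_def]
        split_ifs <;> assumption
      have hσσ : σ (σ d) = d := Equiv.swap_apply_self a i d
      have hσi : σ d = i ↔ d = a := by
        simp only [σ]
        rw [Equiv.swap_apply_eq_iff, Equiv.swap_apply_right]
      by_cases hda : d = a
      · simp [eij, hda]
        simp_all
      · simp [eij, hda, hσi, hd, hσ, hσσ]
    apply blockMap_congr <;> intro c
    · have hd : eij i j c ≠ j := by
        by_cases h1 : c = j <;> simp [eij, h1, hij]
      obtain ⟨h1, h2, h3, h4, h5, h6⟩ := key _ hd
      simp only [end_mul_apply, Pi.mul_apply, Pi.mulSingle_one, Pi.one_apply, mul_one, h1, h2]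
      by_cases hda : eij i j c = a
      · rw [(h5 hda).1, (h5 hda).2, hda]
        simp [mul_assoc]
      · simp [h6 hda, hda]
    · have hd : eij i j c ≠ j := by
        by_cases h1 : c = j <;> simp [eij, h1, hij]
      obtain ⟨h1, h2, h3, h4, h5, h6⟩ := key _ hd
      simp only [end_mul_apply, end_one_apply, h1, h2, h3, h4]
  have h1 := hprod 1
  have h2 := hprod ((X i)⁻¹ * s * X i)
  simp only [mul_one, mul_inv_cancel, Pi.mulSingle_one, one_mul] at h1
  have h3 := M.mul_mem h2 (hinv _ h1)
  simpa [mul_assoc] using h3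

lemma card_pairs_lt (m : ℕ) :
    (Finset.univ.filter fun p : Fin m × Fin m => p.1 < p.2).card = m.choose 2 := by
  simp only [Finset.card_filter, ← Finset.univ_product_univ, Finset.sum_product_right]
  simp only [← Finset.card_filter, Finset.filter_gt_eq_Iio, Fin.card_Iio]
  rw [Fin.sum_univ_eq_sum_range (fun i => i), Finset.sum_range_id, Nat.choose_two_right]

/-- Let `m, n ≥ 2`.  Let `V ⊆ E(D_m)` be a set of rank-`(m−1)` idempotents
of `T_m` generating `T_m \ S_m` as a semigroup.  For each `(i,j) ∈ Ξ_V` (i.e. `i < j` with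
both `e_{ij}, e_{ji} ∈ V`) choose non-empty sets `A_{ij}, B_{ij}` with `S_n` their disjoint
union, and let `W` consist of all `e_{ij;f}` (`f ∈ S_n`) for `(i,j) ∈ Φ_V` (i.e.
`e_{ij} ∈ V` but `e_{ji} ∉ V`), together with all `e_{ij;f}` (`f ∈ A_{ij}`) and all
`e_{ji;f⁻¹}` (`f ∈ B_{ij}`) for `(i,j) ∈ Ξ_V`.  Then `W` consists of idempotents of
`T(X,P)`, the subsemigroup generated by `W` equals
`S_3 = {f ∈ T(X,P) : f̄ ∈ T_m \ S_m, f_1,…,f_m ∈ S_n}`, and `|W| = n!·(m choose 2)`. -/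
theorem stmt_16 (m n : ℕ) (hm : 2 ≤ m) (hn : 2 ≤ n)
    (V : Set (Function.End (Fin m)))
    (hV : V ⊆ {f : Function.End (Fin m) | ∃ i j : Fin m, i ≠ j ∧ f = eij i j})
    (hVgen : (Subsemigroup.closure V : Set (Function.End (Fin m)))
        = {f : Function.End (Fin m) | ¬ Function.Bijective f})
    (A B : Fin m → Fin m → Set (Equiv.Perm (Fin n)))
    (hAB : ∀ i j : Fin m, i < j → eij i j ∈ V → eij j i ∈ V →
      (A i j).Nonempty ∧ (B i j).Nonempty ∧
        A i j ∪ B i j = Set.univ ∧ A i j ∩ B i j = ∅)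
    (W : Set (Function.End (Fin m × Fin n)))
    (hW : W = {w | ∃ i j : Fin m, eij i j ∈ V ∧ eij j i ∉ V ∧
                  ∃ f : Equiv.Perm (Fin n), w = eijf i j ⇑f}
          ∪ {w | ∃ i j : Fin m, i < j ∧ eij i j ∈ V ∧ eij j i ∈ V ∧
                  ((∃ f ∈ A i j, w = eijf i j ⇑f) ∨ (∃ f ∈ B i j, w = eijf j i ⇑f⁻¹))}) :
    (∀ w ∈ W, BP w ∧ w * w = w) ∧
    (Subsemigroup.closure W : Set (Function.End (Fin m × Fin n)))
      = {f | BP f ∧ ¬ Function.Bijective (fbar (show 0 < n by omega) f) ∧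
            ∀ i : Fin m, Function.Bijective (comp' f i)} ∧
    W.ncard = n.factorial * m.choose 2 := by
  have hn0 : 0 < n := by omega
  have hne : ∀ i j : Fin m, eij i j ∈ V → i ≠ j := by
    rintro i j h rfl
    have h' : eij i i ∈ (Subsemigroup.closure V : Set _) := Subsemigroup.subset_closure h
    rw [hVgen, eij_self] at h'
    exact h' Function.bijective_id
  have hVsing : ∀ φ : Function.End (Fin m), ¬ Function.Bijective φ ↔
      φ ∈ Subsemigroup.closure V := fun φ => (Set.ext_iff.1 hVgen φ).symm
  have htour : ∀ i j : Fin m, i ≠ j → eij i j ∈ V ∨ eij j i ∈ V := fun i j hij =>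
    eij_mem_or_eij_mem hV ((hVsing _).1 (not_bijective_eij hij))
  have hWform : ∀ w ∈ W, ∃ i j : Fin m, i ≠ j ∧ ∃ f : Equiv.Perm (Fin n), w = eijf i j ⇑f := by
    rw [hW]
    rintro w (⟨i, j, hij, -, f, rfl⟩ | ⟨i, j, -, hij, hji, ⟨f, -, rfl⟩ | ⟨f, -, rfl⟩⟩)
    · exact ⟨i, j, hne _ _ hij, f, rfl⟩
    · exact ⟨i, j, hne _ _ hij, f, rfl⟩
    · exact ⟨j, i, hne _ _ hji, f⁻¹, rfl⟩
  refine ⟨?_, ?_, ?_⟩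
  · intro w hw
    obtain ⟨i, j, hij, f, rfl⟩ := hWform w hw
    refine ⟨fun a => ⟨eij i j a, fun x => rfl⟩, ?_⟩
    rw [eijf_eq_blockMap, blockMap_mul]
    clear hw hWform hW hV hAB
    apply blockMap_congr <;> intro c <;> by_cases h1 : c = j <;>
      simp_all [eij, end_mul_apply]
  · set T := Subsemigroup.closure W
    have hWT : ∀ w ∈ W, w ∈ T := fun w hw => Subsemigroup.subset_closure hw
    have hE : ∀ i j : Fin m, eij i j ∈ V → ∀ g : Equiv.Perm (Fin n), eijf i j ⇑g ∈ T := by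
      intro i j hij g
      by_cases hji : eij j i ∈ V
      swap
      · exact hWT _ (hW ▸ Or.inl ⟨i, j, hij, hji, g, rfl⟩)
      have hA : ∀ i j : Fin m, i < j → eij i j ∈ V → eij j i ∈ V → ∀ f ∈ A i j,
          eijf i j ⇑f ∈ T := fun i j hlt h h' f hf =>
        hWT _ (hW ▸ Or.inr ⟨i, j, hlt, h, h', Or.inl ⟨f, hf, rfl⟩⟩)
      have hB : ∀ i j : Fin m, i < j → eij i j ∈ V → eij j i ∈ V → ∀ f ∈ B i j,
          eijf j i ⇑f⁻¹ ∈ T := fun i j hlt h h' f hf =>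
        hWT _ (hW ▸ Or.inr ⟨i, j, hlt, h, h', Or.inr ⟨f, hf, rfl⟩⟩)
      rcases lt_or_gt_of_ne (hne i j hij) with hlt | hlt
      · obtain ⟨⟨f, hf⟩, -, hu, -⟩ := hAB i j hlt hij hji
        rcases (hu ▸ Set.mem_univ g : g ∈ A i j ∪ B i j) with hg | hg
        · exact hA i j hlt hij hji g hg
        · exact eijf_mem_of_mem_of_inv_mem T hlt.ne (hA i j hlt hij hji f hf)
            (hB i j hlt hij hji g hg)
      · obtain ⟨-, ⟨b, hb⟩, hu, -⟩ := hAB j i hlt hji hij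
        rcases (hu ▸ Set.mem_univ g⁻¹ : g⁻¹ ∈ A j i ∪ B j i) with hg | hg
        · exact eijf_mem_of_mem_of_inv_mem T hlt.ne' (hB j i hlt hji hij b hb)
            (hA j i hlt hji hij g⁻¹ hg)
        · simpa using hB j i hlt hji hij g⁻¹ hg
    have hlift : ∀ φ : Function.End (Fin m), ¬ Function.Bijective φ →
        ∃ F : Fin m → Equiv.Perm (Fin n), blockMap F φ ∈ T := by
      intro φ hφ
      rw [hVsing] at hφ
      induction hφ using Subsemigroup.closure_induction with
      | mem x hx =>
        obtain ⟨i, j, -, rfl⟩ := hV hx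
        exact ⟨_, eijf_eq_blockMap i j (1 : Equiv.Perm (Fin n)) ▸ hE i j hx 1⟩
      | mul x y _ _ hx hy =>
        obtain ⟨F, hF⟩ := hx
        obtain ⟨G, hG⟩ := hy
        exact ⟨fun c => F (y c) * G c, T.mul_mem hF hG⟩
    apply Set.Subset.antisymm
    · intro w hw
      have : ∃ F : Fin m → Equiv.Perm (Fin n), ∃ φ : Function.End (Fin m),
          ¬ Function.Bijective φ ∧ w = blockMap F φ := by
        induction hw using Subsemigroup.closure_induction with
        | mem x hx =>
          obtain ⟨i, j, hij, f, rfl⟩ := hWform x hx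
          exact ⟨_, _, not_bijective_eij hij, eijf_eq_blockMap i j f⟩
        | mul x y _ _ hx hy =>
          obtain ⟨F, φ, -, rfl⟩ := hx
          obtain ⟨G, ψ, hψ, rfl⟩ := hy
          exact ⟨_, φ * ψ, not_bijective_mul_of_right hψ, blockMap_mul F G φ ψ⟩
      obtain ⟨F, φ, hφ, rfl⟩ := this
      exact ⟨fun i => ⟨φ i, fun x => rfl⟩, hφ, fun i => (F i).bijective⟩
    · rintro f ⟨hBP, hbar, hcomp⟩
      set φ : Function.End (Fin m) := fbar hn0 f
      let F : Fin m → Equiv.Perm (Fin n) := fun i => Equiv.ofBijective _ (hcomp i)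
      have hf : f = blockMap F φ := by
        funext ⟨a, x⟩
        obtain ⟨b, hb⟩ := hBP a
        exact Prod.ext ((hb x).trans (hb _).symm) rfl
      have hinj : ¬ Function.Injective φ := fun h => hbar (Finite.injective_iff_bijective.1 h)
      obtain ⟨i, j, hij, hφij⟩ : ∃ i j : Fin m, eij i j ∈ V ∧ φ i = φ j := by
        simp only [Function.Injective, not_forall] at hinj
        obtain ⟨a, b, hab, hne'⟩ := hinj
        rcases htour a b hne' with h | h
        · exact ⟨a, b, h, hab⟩
        · exact ⟨b, a, h, hab.symm⟩
      obtain ⟨G, hG⟩ := hlift φ hbar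
      have h := T.mul_mem hG (T.mul_mem (blockMap_eij_mem T (hne i j hij) (hE i j hij) hlift
        (G⁻¹ * F)) (hE i j hij ((F i)⁻¹ * F j)))
      change f ∈ T
      have hij' := hne i j hij
      convert h using 1
      rw [hf]
      simp only [eijf_eq_blockMap, blockMap_mul]
      apply blockMap_congr <;> intro c <;> by_cases h1 : c = j <;>
        simp [eij, end_mul_apply, h1, hij', hφij]
  · classical
    let Ψ : (Fin m × Fin m) × Equiv.Perm (Fin n) → Function.End (Fin m × Fin n) := fun p =>
      if eij p.1.1 p.1.2 ∈ V ∧ (eij p.1.2 p.1.1 ∈ V → p.2 ∈ A p.1.1 p.1.2) then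
        eijf p.1.1 p.1.2 ⇑p.2 else eijf p.1.2 p.1.1 ⇑p.2⁻¹
    let I : Finset ((Fin m × Fin m) × Equiv.Perm (Fin n)) :=
      (Finset.univ.filter fun p : Fin m × Fin m => p.1 < p.2) ×ˢ Finset.univ
    have hWI : W = Set.image Ψ I := by
      have hI : ∀ {i j : Fin m} (f : Equiv.Perm (Fin n)), i < j → ((i, j), f) ∈ (I : Set _) :=
        fun f h => by simpa [I] using h
      rw [hW]
      apply Set.Subset.antisymm
      · rintro w (⟨i, j, hij, hji, f, rfl⟩ | ⟨i, j, hlt, hij, hji, ⟨f, hf, rfl⟩ | ⟨f, hf, rfl⟩⟩)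
        · rcases lt_or_gt_of_ne (hne i j hij) with hlt | hlt
          · exact ⟨((i, j), f), hI f hlt, by simp [Ψ, hij, hji]⟩
          · exact ⟨((j, i), f⁻¹), hI _ hlt, by
              simp only [Ψ]
              rw [if_neg fun h => hji h.1, inv_inv]⟩
        · exact ⟨((i, j), f), hI f hlt, by simp [Ψ, hij, hf]⟩
        · have hf' : f ∉ A i j := fun h =>
            (Set.ext_iff.1 (hAB i j hlt hij hji).2.2.2 f).1 ⟨h, hf⟩
          exact ⟨((i, j), f), hI f hlt, by simp [Ψ, hji, hf']⟩
      · rintro _ ⟨⟨⟨i, j⟩, f⟩, hp, rfl⟩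
        have hlt : i < j := by simpa [I] using hp
        simp only [Ψ]
        split_ifs with h
        · by_cases hji : eij j i ∈ V
          · exact Or.inr ⟨i, j, hlt, h.1, hji, Or.inl ⟨f, h.2 hji, rfl⟩⟩
          · exact Or.inl ⟨i, j, h.1, hji, f, rfl⟩
        · by_cases hij : eij i j ∈ V
          · have hji : eij j i ∈ V ∧ f ∉ A i j := by tauto
            refine Or.inr ⟨i, j, hlt, hij, hji.1, Or.inr ⟨f, ?_, rfl⟩⟩
            have hu : f ∈ A i j ∪ B i j := (hAB i j hlt hij hji.1).2.2.1 ▸ Set.mem_univ f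
            exact hu.resolve_left hji.2
          · exact Or.inl ⟨j, i, (htour i j hlt.ne).resolve_left hij, hij, f⁻¹, rfl⟩
    have hinj : Set.InjOn Ψ I := by
      rintro ⟨⟨i, j⟩, f⟩ hp ⟨⟨i', j'⟩, f'⟩ hp' h
      have hlt : i < j := by simpa [I] using hp
      have hlt' : i' < j' := by simpa [I] using hp'
      simp only [Ψ] at h
      split_ifs at h
      · obtain ⟨rfl, rfl, rfl⟩ := eijf_inj hn0 hlt.ne h
        rfl
      · obtain ⟨rfl, rfl, -⟩ := eijf_inj hn0 hlt.ne h
        exact absurd hlt hlt'.asymm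
      · obtain ⟨rfl, rfl, -⟩ := eijf_inj hn0 hlt.ne' h
        exact absurd hlt hlt'.asymm
      · obtain ⟨rfl, rfl, hff⟩ := eijf_inj hn0 hlt.ne' h
        rw [inv_injective hff]
    rw [hWI, hinj.ncard_image, Set.ncard_coe_finset, Finset.card_product,
      card_pairs_lt, Finset.card_univ, Fintype.card_perm, Fintype.card_fin, mul_comm]
end
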